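/- arXiv:2205.08796 — 2 statements merged into one kernel-verified Lean document; each statement's English description precedes it below -/
import Mathlib

section
/- Consider the time-varying nonlinear difference system with multiple delays x(k+1) = A(k) f(x(k)) + Σ_{l=1}^m B_l(k) f(x(k−h_l)) for k ∈ ℤ₊, where 0 < h_1 < … < h_m are positive integers, A(k), B_l(k) ∈ ℝ^{n×n}, and f is a diagonal nonlinearity in the sector K(0,β] with β_i > 0. Assume there exist ξ ≫ 0 and λ ∈ (0,1) such that (|A(k)| + Σ_{l=1}^m λ^{−h_l} |B_l(k)|) D_β ξ ≤ λ ξ componentwise for all k ∈ ℤ₊, where D_β = diag(β_1,…,β_n). Then there exists L > 0 such that for every f ∈ K(0,β], every initial function φ : {−h_m,…,0} → ℝ^n, and the corresponding solution x(k) (defined by the recursion with x(k) = φ(k) for k ∈ {−h_m,…,0}), one has ‖x(k)‖₁ ≤ L λ^k max_{j∈{−h_m,…,0}} ‖φ(j)‖₁ for all k ∈ ℤ₊. -/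
open scoped Matrix

/-- A function in the sector `(0, b]` is dominated by `b * |·|`. -/
theorem abs_le_mul_abs_of_sector {b : ℝ} {g : ℝ → ℝ} (h0 : g 0 = 0)
    (hg : ∀ y : ℝ, y ≠ 0 → 0 < y * g y ∧ y * g y ≤ b * y ^ 2) (y : ℝ) :
    |g y| ≤ b * |y| := by
  rcases eq_or_ne y 0 with rfl | hy
  · simp [h0]
  · obtain ⟨h1, h2⟩ := hg y hy
    have hy' : 0 < |y| := abs_pos.mpr hy
    refine le_of_mul_le_mul_left ?_ hy'
    calc |y| * |g y| = y * g y := by rw [← abs_mul, abs_of_pos h1]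
      _ ≤ b * y ^ 2 := h2
      _ = |y| * (b * |y|) := by rw [← sq_abs]; ring

/-- Componentwise bound of a sum of matrix-vector products by the comparison matrix with weights
`w l`, when each vector is dominated by a multiple of `β * ξ`. -/
theorem abs_mulVec_add_sum_mulVec_le {ι κ : Type*} [Fintype ι] [DecidableEq ι] [Fintype κ]
    (A : Matrix ι ι ℝ) (B : κ → Matrix ι ι ℝ) (w : κ → ℝ) (β ξ : ι → ℝ) (c : ℝ)
    (u : ι → ℝ) (v : κ → ι → ℝ) (hu : ∀ j, |u j| ≤ c * (β j * ξ j))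
    (hv : ∀ l j, |v l j| ≤ c * w l * (β j * ξ j)) (i : ι) :
    |(A *ᵥ u + ∑ l, B l *ᵥ v l) i| ≤
      c * (((Matrix.of fun i j => |A i j| + ∑ l, w l * |B l i j|) *
        Matrix.diagonal β) *ᵥ ξ) i := by
  have hA : |(A *ᵥ u) i| ≤ ∑ j, |A i j| * (c * (β j * ξ j)) := by
    refine (Finset.abs_sum_le_sum_abs _ _).trans (Finset.sum_le_sum fun j _ => ?_)
    rw [abs_mul]
    exact mul_le_mul_of_nonneg_left (hu j) (abs_nonneg _)
  have hB : ∀ l, |(B l *ᵥ v l) i| ≤ ∑ j, |B l i j| * (c * w l * (β j * ξ j)) := fun l => by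
    refine (Finset.abs_sum_le_sum_abs _ _).trans (Finset.sum_le_sum fun j _ => ?_)
    rw [abs_mul]
    exact mul_le_mul_of_nonneg_left (hv l j) (abs_nonneg _)
  calc |(A *ᵥ u + ∑ l, B l *ᵥ v l) i|
      ≤ |(A *ᵥ u) i| + ∑ l, |(B l *ᵥ v l) i| := by
        rw [Pi.add_apply, Finset.sum_apply]
        exact (abs_add_le _ _).trans (add_le_add_right (Finset.abs_sum_le_sum_abs _ _) _)
    _ ≤ ∑ j, |A i j| * (c * (β j * ξ j)) +
          ∑ l, ∑ j, |B l i j| * (c * w l * (β j * ξ j)) :=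
        add_le_add hA (Finset.sum_le_sum fun l _ => hB l)
    _ = _ := by
        rw [Finset.sum_comm, ← Finset.sum_add_distrib, Matrix.mulVec, dotProduct, Finset.mul_sum]
        refine Finset.sum_congr rfl fun j _ => ?_
        rw [Matrix.mul_diagonal, Matrix.of_apply, add_mul, add_mul, mul_add, Finset.sum_mul,
          Finset.sum_mul, Finset.mul_sum]
        congr 1
        · ring
        · exact Finset.sum_congr rfl fun l _ => by ring

/-- Theorem 5: absolute exponential stability of the time-varying nonlinear difference system
with multiple delays `x(k+1) = A(k) f(x(k)) + Σ_l B_l(k) f(x(k-h_l))`, `0 < h_1 < ⋯ < h_m`,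
with sector nonlinearity `f ∈ K(0,β]`, under the condition
`(|A(k)| + Σ_l λ^{-h_l} |B_l(k)|) D_β ξ ≤ λ ξ` for all `k ∈ ℤ₊`. -/
theorem AES_discrete_multiple_delay_time_varying (n m : ℕ)
    (hdel : Fin (m + 1) → ℕ) (hdelpos : ∀ l, 0 < hdel l) (hdelmono : StrictMono hdel)
    (A : ℤ → Matrix (Fin n) (Fin n) ℝ) (B : Fin (m + 1) → ℤ → Matrix (Fin n) (Fin n) ℝ)
    (β : Fin n → ℝ) (hβ : ∀ i, 0 < β i)
    (ξ : Fin n → ℝ) (hξ : ∀ i, 0 < ξ i) (lam : ℝ) (hlam0 : 0 < lam) (hlam1 : lam < 1)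
    (hcond : ∀ k : ℤ, 0 ≤ k → ∀ i,
      (((Matrix.of fun i j =>
            |A k i j| + ∑ l, lam ^ (-(hdel l : ℤ)) * |B l k i j|) *
          Matrix.diagonal β) *ᵥ ξ) i ≤ lam * ξ i) :
    ∃ L : ℝ, 0 < L ∧ ∀ f : Fin n → ℝ → ℝ,
      (∀ i, ∀ y : ℝ, y ≠ 0 → 0 < y * f i y ∧ y * f i y ≤ β i * y ^ 2) →
      (∀ i, f i 0 = 0) →
      ∀ φ : ℤ → Fin n → ℝ, ∀ x : ℤ → Fin n → ℝ,
        (∀ k : ℤ, 0 ≤ k →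
          x (k + 1) = A k *ᵥ (fun i => f i (x k i))
            + ∑ l, B l k *ᵥ (fun i => f i (x (k - hdel l) i))) →
        (∀ k : ℤ, -(hdel (Fin.last m) : ℤ) ≤ k → k ≤ 0 → x k = φ k) →
        ∀ k : ℤ, 0 ≤ k →
          ∑ i, |x k i| ≤ L * lam ^ k *
            (Finset.Icc (-(hdel (Fin.last m) : ℤ)) 0).sup'
              (Finset.nonempty_Icc.mpr (by omega)) (fun j => ∑ i, |φ j i|) := by
  set S := ∑ i, (ξ i)⁻¹
  have hS0 : 0 ≤ S := Finset.sum_nonneg fun i _ => (inv_pos.mpr (hξ i)).le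
  have hξ0 : 0 ≤ ∑ i, ξ i := Finset.sum_nonneg fun i _ => (hξ i).le
  refine ⟨S * ∑ i, ξ i + 1, by positivity, fun f hf hf0 φ x hx hφ => ?_⟩
  set h : ℤ := (hdel (Fin.last m) : ℤ)
  set M := (Finset.Icc (-h) 0).sup' (Finset.nonempty_Icc.mpr (by omega))
    (fun j => ∑ i, |φ j i|)
  have hφM : ∀ k : ℤ, -h ≤ k → k ≤ 0 → ∑ i, |φ k i| ≤ M := fun k h1 h2 =>
    Finset.le_sup' (fun j => ∑ i, |φ j i|) (Finset.mem_Icc.mpr ⟨h1, h2⟩)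
  have hM0 : 0 ≤ M :=
    (Finset.sum_nonneg fun i _ => abs_nonneg (φ 0 i)).trans (hφM 0 (by omega) le_rfl)
  have hle : ∀ l, (hdel l : ℤ) ≤ h := fun l => by
    exact Int.ofNat_le.mpr (hdelmono.monotone (Fin.le_last l))
  have hinit : ∀ k : ℤ, -h ≤ k → k ≤ 0 → ∀ i, |x k i| ≤ S * M * lam ^ k * ξ i := by
    intro k h1 h2 i
    have hlam : 1 ≤ lam ^ k := one_le_zpow_of_nonpos₀ hlam0 hlam1.le h2
    have hSξ : 1 ≤ S * ξ i := by
      rw [← inv_mul_cancel₀ (hξ i).ne']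
      exact mul_le_mul_of_nonneg_right
        (Finset.single_le_sum (f := fun i => (ξ i)⁻¹)
          (fun j _ => (inv_pos.mpr (hξ j)).le) (Finset.mem_univ i)) (hξ i).le
    rw [hφ k h1 h2]
    calc |φ k i| ≤ ∑ i, |φ k i| :=
          Finset.single_le_sum (f := fun i => |φ k i|) (fun j _ => abs_nonneg _)
            (Finset.mem_univ i)
      _ ≤ M := hφM k h1 h2
      _ ≤ M * ((S * ξ i) * lam ^ k) :=
          le_mul_of_one_le_right hM0 (one_le_mul_of_one_le_of_one_le hSξ hlam)
      _ = S * M * lam ^ k * ξ i := by ring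
  have hsec : ∀ i k, |x k i| ≤ S * M * lam ^ k * ξ i →
      |f i (x k i)| ≤ S * M * lam ^ k * (β i * ξ i) := fun i k hk =>
    calc |f i (x k i)| ≤ β i * |x k i| := abs_le_mul_abs_of_sector (hf0 i) (hf i) _
      _ ≤ β i * (S * M * lam ^ k * ξ i) := mul_le_mul_of_nonneg_left hk (hβ i).le
      _ = S * M * lam ^ k * (β i * ξ i) := by ring
  have hbound : ∀ N : ℕ, ∀ k : ℤ, -h ≤ k → k ≤ N → ∀ i,
      |x k i| ≤ S * M * lam ^ k * ξ i := by
    intro N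
    induction N with
    | zero => exact fun k h1 h2 => hinit k h1 (by simpa using h2)
    | succ N ih =>
      intro k h1 h2 i
      rcases (show k ≤ N ∨ k = N + 1 by push_cast at h2; omega) with hk | rfl
      · exact ih k h1 hk i
      rw [hx N (by positivity)]
      calc _ ≤ S * M * lam ^ (N : ℤ) * _ :=
            abs_mulVec_add_sum_mulVec_le (A N) (fun l => B l N)
              (fun l => lam ^ (-(hdel l : ℤ))) β ξ _ _
              (fun l i => f i (x (N - hdel l) i))
              (fun j => hsec j N (ih N (by omega) le_rfl j))
              (fun l j => by
                have := hsec j (N - hdel l)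
                  (ih _ (by have := hle l; omega) (by omega) j)
                rwa [sub_eq_add_neg (N : ℤ), zpow_add₀ hlam0.ne', ← sub_eq_add_neg,
                  ← mul_assoc (S * M)] at this) i
        _ ≤ S * M * lam ^ (N : ℤ) * (lam * ξ i) :=
            mul_le_mul_of_nonneg_left (hcond N (by positivity) i) (by positivity)
        _ = S * M * lam ^ ((N : ℤ) + 1) * ξ i := by
            rw [zpow_add_one₀ hlam0.ne']; ring
  intro k hk
  calc ∑ i, |x k i| ≤ ∑ i, S * M * lam ^ k * ξ i :=
        Finset.sum_le_sum fun i _ => hbound k.toNat k (by omega) (by omega) i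
    _ = (S * ∑ i, ξ i) * (lam ^ k * M) := by rw [← Finset.mul_sum]; ring
    _ ≤ (S * ∑ i, ξ i + 1) * (lam ^ k * M) :=
        mul_le_mul_of_nonneg_right (by linarith) (by positivity)
    _ = (S * ∑ i, ξ i + 1) * lam ^ k * M := by ring
end

section
/- Consider the time-invariant delay positive nonlinear difference system x(k+1) = A f(x(k)) + Σ_{l=1}^m B_l f(x(k−h_l)) for k ∈ ℤ₊, where 0 < h_1 < … < h_m are positive integers, A and B_1,…,B_m are nonnegative n×n matrices, and f is a diagonal nonlinearity in the sector K(0,β] with β_i > 0. Assume there exists a vector ξ ≫ 0 satisfying (A + B_1 + … + B_m) D_β ξ − ξ ≪ 0, where D_β = diag(β_1,…,β_n). Then there exist L > 0 and λ ∈ (0,1) such that for every f ∈ K(0,β], every initial function φ : {−h_m,…,0} → ℝ^n, and the corresponding solution x(k) of the recursion with x(k) = φ(k) for k ∈ {−h_m,…,0}, one has ‖x(k)‖₁ ≤ L λ^k max_{j∈{−h_m,…,0}} ‖φ(j)‖₁ for all k ∈ ℤ₊. Moreover, the same exponential bound (with the same λ) holds for every time-varying system x(k+1) = Ã(k) f(x(k))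 + Σ_{l=1}^m B̃_l(k) f(x(k−h_l)) whose matrix functions satisfy |Ã(k)| ≤ A and |B̃_l(k)| ≤ B_l entrywise for all k ∈ ℤ₊ and all l. -/
open scoped Matrix

/-- A strict finite family of inequalities `v i < ξ i` leaves room for a factor `lam ^ d` with
`lam < 1`. -/
theorem exists_rate_of_forall_lt {ι : Type*} [Finite ι] (v ξ : ι → ℝ) (h : ∀ i, v i < ξ i)
    (d : ℕ) : ∃ lam : ℝ, 0 < lam ∧ lam < 1 ∧ ∀ i, v i ≤ lam ^ d * ξ i := by
  have hev : ∀ᶠ lam : ℝ in nhdsWithin 1 (Set.Iio 1), ∀ i, v i < lam ^ d * ξ i := by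
    rw [Filter.eventually_all]
    intro i
    have hcont : Filter.Tendsto (fun lam : ℝ => lam ^ d * ξ i) (nhdsWithin 1 (Set.Iio 1))
        (nhds (1 ^ d * ξ i)) :=
      (Continuous.tendsto (by fun_prop) 1).mono_left nhdsWithin_le_nhds
    exact hcont.eventually_const_lt (by simpa using h i)
  have hpos : ∀ᶠ lam : ℝ in nhdsWithin 1 (Set.Iio 1), 0 < lam :=
    nhdsWithin_le_nhds (lt_mem_nhds one_pos)
  obtain ⟨lam, ⟨h1, h2⟩, h3⟩ := ((hev.and hpos).and self_mem_nhdsWithin).exists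
  exact ⟨lam, h2, h3, fun i => (h1 i).le⟩

/-- The sector condition bounds the nonlinearity linearly. -/
theorem abs_le_of_sector {g : ℝ → ℝ} {b : ℝ}
    (hg : ∀ y : ℝ, y ≠ 0 → 0 < y * g y ∧ y * g y ≤ b * y ^ 2) (hg0 : g 0 = 0) (y : ℝ) :
    |g y| ≤ b * |y| := by
  rcases eq_or_ne y 0 with rfl | hy
  · simp [hg0]
  · obtain ⟨h1, h2⟩ := hg y hy
    have hy' : 0 < |y| := abs_pos.mpr hy
    refine le_of_mul_le_mul_left ?_ hy'
    rw [← abs_mul, abs_of_pos h1]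
    calc y * g y ≤ b * y ^ 2 := h2
      _ = |y| * (b * |y|) := by rw [← sq_abs]; ring

/-- Entrywise comparison of a matrix-vector product with a dominating matrix and vector. -/
theorem abs_mulVec_le {n : Type*} [Fintype n] {M N : Matrix n n ℝ} {u w : n → ℝ}
    (hMN : ∀ i j, |M i j| ≤ N i j) (huw : ∀ j, |u j| ≤ w j) (i : n) :
    |(M *ᵥ u) i| ≤ (N *ᵥ w) i := by
  refine (Finset.abs_sum_le_sum_abs _ _).trans (Finset.sum_le_sum fun j _ => ?_)
  rw [abs_mul]
  exact mul_le_mul (hMN i j) (huw j) (abs_nonneg _) ((abs_nonneg _).trans (hMN i j))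

/-- A weighted supremum bound on the initial data propagates, with geometric decay, along every
delay recursion dominated by a nonnegative one. -/
theorem abs_le_geometric_of_delay_recursion {n ι : Type*} [Fintype n] [DecidableEq n] [Fintype ι]
    {h : ι → ℕ} {H : ℕ} (hH : ∀ l, h l ≤ H)
    {A : Matrix n n ℝ} {B : ι → Matrix n n ℝ} {β ξ : n → ℝ}
    (hβ : ∀ i, 0 < β i) {lam C : ℝ} (hlam : 0 < lam) (hlam1 : lam < 1) (hC : 0 ≤ C)
    (hξ : ∀ i, 0 < ξ i)
    (hrate : ∀ i, (((A + ∑ l, B l) * Matrix.diagonal β) *ᵥ ξ) i ≤ lam ^ (H + 1) * ξ i)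
    {Atil : ℤ → Matrix n n ℝ} {Btil : ι → ℤ → Matrix n n ℝ}
    (hA : ∀ k : ℤ, 0 ≤ k → ∀ i j, |Atil k i j| ≤ A i j)
    (hB : ∀ l, ∀ k : ℤ, 0 ≤ k → ∀ i j, |Btil l k i j| ≤ B l i j)
    {f : n → ℝ → ℝ} (hf : ∀ i y, |f i y| ≤ β i * |y|) {x : ℤ → n → ℝ}
    (hx : ∀ k : ℤ, 0 ≤ k → x (k + 1) = Atil k *ᵥ (fun i => f i (x k i))
      + ∑ l, Btil l k *ᵥ (fun i => f i (x (k - h l) i)))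
    (hinit : ∀ k : ℤ, -(H : ℤ) ≤ k → k ≤ 0 → ∀ i, |x k i| ≤ C * ξ i) (N : ℕ) :
    ∀ k : ℤ, -(H : ℤ) ≤ k → k ≤ N → ∀ i, |x k i| ≤ C * lam ^ k * ξ i := by
  induction N with
  | zero =>
    intro k hk hk0 i
    have hk0' : k ≤ 0 := by simpa using hk0
    refine (hinit k hk hk0' i).trans ?_
    have h1 : (1 : ℝ) ≤ lam ^ k := one_le_zpow_of_nonpos₀ hlam hlam1.le hk0'
    exact mul_le_mul_of_nonneg_right (le_mul_of_one_le_right hC h1) (hξ i).le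
  | succ N ih =>
    intro k hk hkN i
    rcases (show k ≤ N ∨ k = (N : ℤ) + 1 by push_cast at hkN; omega) with hkN' | rfl
    · exact ih k hk hkN' i
    set c : ℝ := C * lam ^ ((N : ℤ) - H) with hc
    have hpast : ∀ p : ℤ, (N : ℤ) - H ≤ p → p ≤ N →
        ∀ j, |f j (x p j)| ≤ (c • (Matrix.diagonal β *ᵥ ξ)) j := by
      intro p hp hpN j
      have hpow : lam ^ p ≤ lam ^ ((N : ℤ) - H) :=
        zpow_le_zpow_right_of_le_one₀ hlam hlam1.le hp
      calc |f j (x p j)| ≤ β j * |x p j| := hf j _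
        _ ≤ β j * (C * lam ^ p * ξ j) :=
          mul_le_mul_of_nonneg_left (ih p (by omega) hpN j) (hβ j).le
        _ ≤ β j * (c * ξ j) := by
          have := hβ j
          have := hξ j
          rw [hc]
          gcongr
        _ = (c • (Matrix.diagonal β *ᵥ ξ)) j := by
          simp only [Pi.smul_apply, Matrix.mulVec_diagonal, smul_eq_mul]; ring
    have hN : (0 : ℤ) ≤ N := by positivity
    have hcnn : 0 ≤ c := by positivity
    rw [hx N hN, Pi.add_apply, Finset.sum_apply]
    calc _ ≤ |(Atil N *ᵥ fun i => f i (x N i)) i|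
          + ∑ l, |(Btil l N *ᵥ fun i => f i (x (N - h l) i)) i| :=
          (abs_add_le _ _).trans (add_le_add_right (Finset.abs_sum_le_sum_abs _ _) _)
      _ ≤ (A *ᵥ (c • (Matrix.diagonal β *ᵥ ξ))) i
          + ∑ l, (B l *ᵥ (c • (Matrix.diagonal β *ᵥ ξ))) i := by
          refine add_le_add (abs_mulVec_le (hA N hN) (hpast N (by omega) le_rfl) i)
            (Finset.sum_le_sum fun l _ => abs_mulVec_le (hB l N hN) (hpast _ ?_ ?_) i)
          · have := hH l
            omega
          · omega
      _ = c * (((A + ∑ l, B l) * Matrix.diagonal β) *ᵥ ξ) i := by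
          rw [← Matrix.mulVec_mulVec, Matrix.add_mulVec, Matrix.sum_mulVec]
          simp only [Matrix.mulVec_smul, Pi.add_apply, Finset.sum_apply, Pi.smul_apply,
            smul_eq_mul, mul_add, Finset.mul_sum]
      _ ≤ c * (lam ^ (H + 1) * ξ i) := mul_le_mul_of_nonneg_left (hrate i) hcnn
      _ = C * lam ^ ((N : ℤ) + 1) * ξ i := by
          have : lam ^ ((N : ℤ) - H) * lam ^ (H + 1) = lam ^ ((N : ℤ) + 1) := by
            rw [← zpow_natCast, ← zpow_add₀ hlam.ne']
            congr 1
            push_cast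
            ring
          rw [hc, ← this]
          ring

/-- Corollary 4: the delay positive nonlinear difference system
`x(k+1) = A f(x(k)) + Σ_l B_l f(x(k-h_l))` with nonnegative matrices and sector nonlinearity
`f ∈ K(0,β]` is absolutely exponentially stable provided `(A + B_1 + ⋯ + B_m) D_β ξ - ξ ≪ 0`
for some `ξ ≫ 0`; moreover the same exponential bound (with the same `λ`) holds for every
time-varying system whose matrices satisfy `|Ã(k)| ≤ A`, `|B̃_l(k)| ≤ B_l`. -/
theorem AES_discrete_time_invariant_positive (n m : ℕ)
    (hdel : Fin (m + 1) → ℕ) (hdelpos : ∀ l, 0 < hdel l) (hdelmono : StrictMono hdel)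
    (A : Matrix (Fin n) (Fin n) ℝ) (B : Fin (m + 1) → Matrix (Fin n) (Fin n) ℝ)
    (hAnonneg : ∀ i j, 0 ≤ A i j) (hBnonneg : ∀ l i j, 0 ≤ B l i j)
    (β : Fin n → ℝ) (hβ : ∀ i, 0 < β i)
    (ξ : Fin n → ℝ) (hξ : ∀ i, 0 < ξ i)
    (hcond : ∀ i, (((A + ∑ l, B l) * Matrix.diagonal β) *ᵥ ξ) i - ξ i < 0) :
    ∃ L : ℝ, 0 < L ∧ ∃ lam : ℝ, 0 < lam ∧ lam < 1 ∧
      ((∀ f : Fin n → ℝ → ℝ,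
        (∀ i, ∀ y : ℝ, y ≠ 0 → 0 < y * f i y ∧ y * f i y ≤ β i * y ^ 2) →
        (∀ i, f i 0 = 0) →
        ∀ φ : ℤ → Fin n → ℝ, ∀ x : ℤ → Fin n → ℝ,
          (∀ k : ℤ, 0 ≤ k →
            x (k + 1) = A *ᵥ (fun i => f i (x k i))
              + ∑ l, B l *ᵥ (fun i => f i (x (k - hdel l) i))) →
          (∀ k : ℤ, -(hdel (Fin.last m) : ℤ) ≤ k → k ≤ 0 → x k = φ k) →
          ∀ k : ℤ, 0 ≤ k →
            ∑ i, |x k i| ≤ L * lam ^ k *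
              (Finset.Icc (-(hdel (Fin.last m) : ℤ)) 0).sup'
                (Finset.nonempty_Icc.mpr (by omega)) (fun j => ∑ i, |φ j i|))
      ∧ (∀ Atil : ℤ → Matrix (Fin n) (Fin n) ℝ,
         ∀ Btil : Fin (m + 1) → ℤ → Matrix (Fin n) (Fin n) ℝ,
          (∀ k : ℤ, 0 ≤ k → ∀ i j, |Atil k i j| ≤ A i j) →
          (∀ l, ∀ k : ℤ, 0 ≤ k → ∀ i j, |Btil l k i j| ≤ B l i j) →
          ∀ f : Fin n → ℝ → ℝ,
            (∀ i, ∀ y : ℝ, y ≠ 0 → 0 < y * f i y ∧ y * f i y ≤ β i * y ^ 2) →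
            (∀ i, f i 0 = 0) →
            ∀ φ : ℤ → Fin n → ℝ, ∀ x : ℤ → Fin n → ℝ,
              (∀ k : ℤ, 0 ≤ k →
                x (k + 1) = Atil k *ᵥ (fun i => f i (x k i))
                  + ∑ l, Btil l k *ᵥ (fun i => f i (x (k - hdel l) i))) →
              (∀ k : ℤ, -(hdel (Fin.last m) : ℤ) ≤ k → k ≤ 0 → x k = φ k) →
              ∀ k : ℤ, 0 ≤ k →
                ∑ i, |x k i| ≤ L * lam ^ k *
                  (Finset.Icc (-(hdel (Fin.last m) : ℤ)) 0).sup'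
                    (Finset.nonempty_Icc.mpr (by omega)) (fun j => ∑ i, |φ j i|))) := by
  obtain ⟨lam, hlam, hlam1, hrate⟩ := exists_rate_of_forall_lt
    (fun i => (((A + ∑ l, B l) * Matrix.diagonal β) *ᵥ ξ) i) ξ
    (fun i => sub_neg.mp (hcond i)) (hdel (Fin.last m) + 1)
  have hinv : ∀ i, 0 ≤ (ξ i)⁻¹ := fun i => (inv_pos.mpr (hξ i)).le
  have hK : 0 ≤ ∑ i, (ξ i)⁻¹ := Finset.sum_nonneg fun i _ => hinv i
  have hS : 0 ≤ ∑ i, ξ i := Finset.sum_nonneg fun i _ => (hξ i).le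
  refine ⟨(∑ i, (ξ i)⁻¹) * (∑ i, ξ i) + 1, by positivity, lam, hlam, hlam1, ?_⟩
  refine (and_iff_right_of_imp fun hvar => ?_).mpr ?_
  · intro f hf hf0 φ x hx hφ
    exact hvar (fun _ => A) (fun l _ => B l) (fun _ _ i j => (abs_of_nonneg (hAnonneg i j)).le)
      (fun l _ _ i j => (abs_of_nonneg (hBnonneg l i j)).le) f hf hf0 φ x hx hφ
  intro Atil Btil hA hB f hf hf0 φ x hx hφ k hk
  set M : ℝ := (Finset.Icc (-(hdel (Fin.last m) : ℤ)) 0).sup'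
    (Finset.nonempty_Icc.mpr (by omega)) (fun j => ∑ i, |φ j i|) with hM
  have hle : ∀ j : ℤ, -(hdel (Fin.last m) : ℤ) ≤ j → j ≤ 0 → ∑ i, |φ j i| ≤ M :=
    fun j h1 h2 => Finset.le_sup' (fun j => ∑ i, |φ j i|) (Finset.mem_Icc.mpr ⟨h1, h2⟩)
  have hM0 : 0 ≤ M :=
    (Finset.sum_nonneg fun i _ => abs_nonneg (φ 0 i)).trans (hle 0 (by omega) le_rfl)
  have hinit : ∀ j : ℤ, -(hdel (Fin.last m) : ℤ) ≤ j → j ≤ 0 →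
      ∀ i, |x j i| ≤ M * (∑ i, (ξ i)⁻¹) * ξ i := by
    intro j h1 h2 i
    have hone : 1 ≤ (∑ i, (ξ i)⁻¹) * ξ i := by
      rw [← inv_mul_cancel₀ (hξ i).ne']
      exact mul_le_mul_of_nonneg_right
        (Finset.single_le_sum (fun i _ => hinv i) (Finset.mem_univ i)) (hξ i).le
    calc |x j i| = |φ j i| := by rw [hφ j h1 h2]
      _ ≤ ∑ i, |φ j i| :=
        Finset.single_le_sum (fun i _ => abs_nonneg (φ j i)) (Finset.mem_univ i)
      _ ≤ M := hle j h1 h2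
      _ ≤ M * ((∑ i, (ξ i)⁻¹) * ξ i) := le_mul_of_one_le_right hM0 hone
      _ = M * (∑ i, (ξ i)⁻¹) * ξ i := (mul_assoc _ _ _).symm
  have hbound := abs_le_geometric_of_delay_recursion
    (fun l => hdelmono.monotone (Fin.le_last l)) hβ hlam hlam1 (mul_nonneg hM0 hK) hξ hrate
    hA hB (fun i => abs_le_of_sector (hf i) (hf0 i)) hx hinit k.toNat k (by omega) (by omega)
  calc ∑ i, |x k i| ≤ ∑ i, M * (∑ i, (ξ i)⁻¹) * lam ^ k * ξ i :=
        Finset.sum_le_sum fun i _ => hbound i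
    _ = (∑ i, (ξ i)⁻¹) * (∑ i, ξ i) * lam ^ k * M := by rw [← Finset.mul_sum]; ring
    _ ≤ ((∑ i, (ξ i)⁻¹) * (∑ i, ξ i) + 1) * lam ^ k * M := by
      gcongr
      linarith
end
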